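/- Let X ⊆ ℙᵐ × ℙⁿ be a closed subset, let ℓ_x ∈ ℂ[x₀, …, x_m] and ℓ_y ∈ ℂ[y₀, …, y_n] be homogeneous of degree 1, and let g₀ ∈ ℂ[u, x, v, y] be bihomogeneous of bidegree (d, e) with d, e ≥ 1 in the variable groups (u, x) and (v, y). Assume X ∩ V(ℓ_x) ∩ V(ℓ_y) = ∅ and g₀(1, 𝟎, 1, 𝟎) ≠ 0. Then X̃ ∩ V(g₀, ℓ_x, ℓ_y) = { ([u : x], [1 : 𝟎]) : [x] ∈ π_x(X), ℓ_x(x) = 0, g₀(u, x, 1, 𝟎) = 0 } ∪ { ([1 : 𝟎], [v : y]) : [y] ∈ π_y(X), ℓ_y(y) = 0, g₀(1, 𝟎, v, y) = 0 }, and these two sets are disjoint. -/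

import Mathlib

open MvPolynomial

noncomputable section

namespace UGen

/-- The (quotient of the Euclidean) topology on the projectivization of `ℂ^N`. -/
instance {N : ℕ} : TopologicalSpace (Projectivization ℂ (Fin N → ℂ)) :=
  inferInstanceAs (TopologicalSpace (Quotient (projectivizationSetoid ℂ (Fin N → ℂ))))

lemma cons_ne_zero {N : ℕ} (u : ℂ) {x : Fin N → ℂ} (hx : x ≠ 0) :
    (Fin.cons u x : Fin (N + 1) → ℂ) ≠ 0 := by
  intro h
  apply hx
  funext i
  simpa using congrFun h i.succ

lemma one_zero_ne_zero {N : ℕ} : (Fin.cons 1 0 : Fin (N + 1) → ℂ) ≠ 0 := by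
  intro h
  simpa using congrFun h 0

/-- The distinguished point `[1 : 0 : ⋯ : 0]`. -/
def e0 {N : ℕ} : Projectivization ℂ (Fin (N + 1) → ℂ) :=
  Projectivization.mk ℂ (Fin.cons 1 0) one_zero_ne_zero

/-- The vanishing locus in `ℙ^{N-1}` of a polynomial in `N` variables (for homogeneous
polynomials vanishing does not depend on the representative; we require vanishing at
every representative). -/
def Vp {N : ℕ} (h : MvPolynomial (Fin N) ℂ) : Set (Projectivization ℂ (Fin N → ℂ)) :=
  { p | ∀ (w : Fin N → ℂ) (hw : w ≠ 0), p = Projectivization.mk ℂ w hw → eval w h = 0 }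

/-- The "open part" of the cone over `X ⊆ ℙⁿ`: all points `[u : x]` with `[x] ∈ X`. -/
def coneO {n : ℕ} (X : Set (Projectivization ℂ (Fin (n + 1) → ℂ))) :
    Set (Projectivization ℂ (Fin (n + 2) → ℂ)) :=
  { q | ∃ (u : ℂ) (x : Fin (n + 1) → ℂ) (hx : x ≠ 0),
      Projectivization.mk ℂ x hx ∈ X ∧
        q = Projectivization.mk ℂ (Fin.cons u x) (cons_ne_zero u hx) }

/-- The cone `X̃ ⊆ ℙ^{n+1}` over `X ⊆ ℙⁿ`. -/
def cone {n : ℕ} (X : Set (Projectivization ℂ (Fin (n + 1) → ℂ))) :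
    Set (Projectivization ℂ (Fin (n + 2) → ℂ)) :=
  coneO X ∪ {e0}

end UGen

namespace UGen

lemma cons_pair_ne_zero {N : ℕ} {a b : ℂ} (hab : (a, b) ≠ (0, 0)) {x : Fin N → ℂ}
    (hx : x ≠ 0) : (Fin.cons a (b • x) : Fin (N + 1) → ℂ) ≠ 0 := by
  rcases eq_or_ne b 0 with hb | hb
  · subst hb
    have ha : a ≠ 0 := by simpa using hab
    intro h
    exact ha (by simpa using congrFun h 0)
  · exact cons_ne_zero a (smul_ne_zero hb hx)

/-- Bihomogeneity of bidegree `(d, e)` in two groups of variables,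
phrased via weighted homogeneity with weights `(1,0)` and `(0,1)`. -/
def IsBihomogeneous {a b : ℕ} (g : MvPolynomial (Fin a ⊕ Fin b) ℂ) (d e : ℕ) : Prop :=
  g.IsWeightedHomogeneous
    (Sum.elim (fun _ => ((1 : ℕ), (0 : ℕ))) (fun _ => ((0 : ℕ), (1 : ℕ)))) (d, e)

/-- The vanishing locus, in a product of two projectivizations, of a polynomial in the two
groups of variables (for bihomogeneous polynomials vanishing does not depend on the chosen
representatives; we require vanishing at every pair of representatives). -/
def Vbi {a b : ℕ} (h : MvPolynomial (Fin a ⊕ Fin b) ℂ) :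
    Set (Projectivization ℂ (Fin a → ℂ) × Projectivization ℂ (Fin b → ℂ)) :=
  { p | ∀ (w₁ : Fin a → ℂ) (h₁ : w₁ ≠ 0) (w₂ : Fin b → ℂ) (h₂ : w₂ ≠ 0),
      p = (Projectivization.mk ℂ w₁ h₁, Projectivization.mk ℂ w₂ h₂) →
        eval (Sum.elim w₁ w₂) h = 0 }

variable {m n : ℕ}
  (X : Set (Projectivization ℂ (Fin (m + 1) → ℂ) × Projectivization ℂ (Fin (n + 1) → ℂ)))

/-- The "open part" of the double cone: all points `([u : x], [v : y])` with `([x],[y]) ∈ X`. -/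
def dcT : Set (Projectivization ℂ (Fin (m + 2) → ℂ) × Projectivization ℂ (Fin (n + 2) → ℂ)) :=
  { q | ∃ (u v : ℂ) (x : Fin (m + 1) → ℂ) (y : Fin (n + 1) → ℂ) (hx : x ≠ 0) (hy : y ≠ 0),
      (Projectivization.mk ℂ x hx, Projectivization.mk ℂ y hy) ∈ X ∧
        q = (Projectivization.mk ℂ (Fin.cons u x) (cons_ne_zero u hx),
             Projectivization.mk ℂ (Fin.cons v y) (cons_ne_zero v hy)) }

/-- The part `{([u : x], [1 : 𝟎]) : [x] ∈ π_x(X)}` of the double cone. -/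
def dcA : Set (Projectivization ℂ (Fin (m + 2) → ℂ) × Projectivization ℂ (Fin (n + 2) → ℂ)) :=
  { q | ∃ (u : ℂ) (x : Fin (m + 1) → ℂ) (hx : x ≠ 0),
      Projectivization.mk ℂ x hx ∈ Prod.fst '' X ∧
        q = (Projectivization.mk ℂ (Fin.cons u x) (cons_ne_zero u hx), e0) }

/-- The part `{([1 : 𝟎], [v : y]) : [y] ∈ π_y(X)}` of the double cone. -/
def dcB : Set (Projectivization ℂ (Fin (m + 2) → ℂ) × Projectivization ℂ (Fin (n + 2) → ℂ)) :=
  { q | ∃ (v : ℂ) (y : Fin (n + 1) → ℂ) (hy : y ≠ 0),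
      Projectivization.mk ℂ y hy ∈ Prod.snd '' X ∧
        q = (e0, Projectivization.mk ℂ (Fin.cons v y) (cons_ne_zero v hy)) }

/-- The double cone `X̃ ⊆ ℙ^{m+1} × ℙ^{n+1}` of `X ⊆ ℙᵐ × ℙⁿ`. -/
def doubleCone :
    Set (Projectivization ℂ (Fin (m + 2) → ℂ) × Projectivization ℂ (Fin (n + 2) → ℂ)) :=
  dcT X ∪ dcA X ∪ dcB X ∪ {(e0, e0)}

end UGen

namespace UGen

/-- Scaling the variables of a weighted homogeneous polynomial through a character `χ` of the
monoid of weights scales its value by `χ` of the degree. -/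
lemma eval_mul_of_isWeightedHomogeneous {σ M R : Type*} [CommSemiring R] [AddCommMonoid M]
    {w : σ → M} {k : M} {φ : MvPolynomial σ R} (hφ : φ.IsWeightedHomogeneous w k)
    (χ : Multiplicative M →* R) (x : σ → R) :
    eval (fun i => χ (Multiplicative.ofAdd (w i)) * x i) φ =
      χ (Multiplicative.ofAdd k) * eval x φ := by
  rw [eval_eq, eval_eq, Finset.mul_sum]
  refine Finset.sum_congr rfl fun s hs => ?_
  have hk := hφ (mem_support_iff.mp hs)
  rw [Finsupp.weight_apply, Finsupp.sum] at hk
  simp only [mul_pow, Finset.prod_mul_distrib, ← hk, ofAdd_sum, map_prod, ofAdd_nsmul, map_pow]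
  ring

lemma eval_smul_of_isHomogeneous {σ R : Type*} [CommSemiring R] {k : ℕ} {φ : MvPolynomial σ R}
    (hφ : φ.IsHomogeneous k) (a : R) (x : σ → R) :
    eval (a • x) φ = a ^ k * eval x φ := by
  have h := eval_mul_of_isWeightedHomogeneous hφ (powersHom R a) x
  simpa [powersHom_apply, Pi.smul_def] using h

lemma eval_zero_of_isHomogeneous {σ R : Type*} [CommSemiring R] {k : ℕ} (hk : k ≠ 0)
    {φ : MvPolynomial σ R} (hφ : φ.IsHomogeneous k) : eval (0 : σ → R) φ = 0 := by
  simpa [hk] using eval_smul_of_isHomogeneous hφ 0 0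

lemma IsBihomogeneous.eval_smul {a b d e : ℕ} {g : MvPolynomial (Fin a ⊕ Fin b) ℂ}
    (hg : IsBihomogeneous g d e) (s t : ℂ) (x : Fin a → ℂ) (y : Fin b → ℂ) :
    eval (Sum.elim (s • x) (t • y)) g = s ^ d * t ^ e * eval (Sum.elim x y) g := by
  let χ : Multiplicative (ℕ × ℕ) →* ℂ :=
    { toFun := fun p => s ^ p.toAdd.1 * t ^ p.toAdd.2
      map_one' := by simp
      map_mul' := fun p q => by simp [pow_add]; ring }
  have h := eval_mul_of_isWeightedHomogeneous hg χ (Sum.elim x y)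
  have hvars : (fun i => χ (Multiplicative.ofAdd
      (Sum.elim (fun _ => ((1 : ℕ), (0 : ℕ))) (fun _ => ((0 : ℕ), (1 : ℕ))) i)) *
        Sum.elim x y i) = Sum.elim (s • x) (t • y) := by
    funext i
    cases i <;> simp [χ]
  rw [hvars] at h
  exact h

/-- If vanishing of `h` is stable under scaling, membership in `Vbi h` is tested on one pair of
representatives. -/
lemma mk_mem_Vbi_iff {a b : ℕ} {h : MvPolynomial (Fin a ⊕ Fin b) ℂ}
    (hs : ∀ (s t : ℂ) x y, eval (Sum.elim x y) h = 0 → eval (Sum.elim (s • x) (t • y)) h = 0)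
    {x : Fin a → ℂ} (hx : x ≠ 0) {y : Fin b → ℂ} (hy : y ≠ 0) :
    (Projectivization.mk ℂ x hx, Projectivization.mk ℂ y hy) ∈ Vbi h ↔
      eval (Sum.elim x y) h = 0 := by
  refine ⟨fun H => H x hx y hy rfl, fun H w₁ h₁ w₂ h₂ hw => ?_⟩
  obtain ⟨hw₁, hw₂⟩ := Prod.mk.inj hw
  obtain ⟨s, rfl⟩ := (Projectivization.mk_eq_mk_iff' ℂ _ _ _ _).mp hw₁.symm
  obtain ⟨t, rfl⟩ := (Projectivization.mk_eq_mk_iff' ℂ _ _ _ _).mp hw₂.symm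
  exact hs s t x y H

lemma IsBihomogeneous.mk_mem_Vbi_iff {a b d e : ℕ} {g : MvPolynomial (Fin a ⊕ Fin b) ℂ}
    (hg : IsBihomogeneous g d e) {x : Fin a → ℂ} (hx : x ≠ 0) {y : Fin b → ℂ} (hy : y ≠ 0) :
    (Projectivization.mk ℂ x hx, Projectivization.mk ℂ y hy) ∈ Vbi g ↔
      eval (Sum.elim x y) g = 0 :=
  UGen.mk_mem_Vbi_iff (fun s t x y h => by rw [hg.eval_smul, h, mul_zero]) hx hy

lemma mk_mem_Vbi_rename_inl_iff {a b c k : ℕ} {φ : MvPolynomial (Fin c) ℂ}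
    (hφ : φ.IsHomogeneous k) (f : Fin c → Fin a)
    {x : Fin a → ℂ} (hx : x ≠ 0) {y : Fin b → ℂ} (hy : y ≠ 0) :
    (Projectivization.mk ℂ x hx, Projectivization.mk ℂ y hy) ∈ Vbi (rename (Sum.inl ∘ f) φ) ↔
      eval (x ∘ f) φ = 0 := by
  have key (x : Fin a → ℂ) (y : Fin b → ℂ) :
      eval (Sum.elim x y) (rename (Sum.inl ∘ f) φ) = eval (x ∘ f) φ := by
    rw [eval_rename, ← Function.comp_assoc, Sum.elim_comp_inl]
  rw [mk_mem_Vbi_iff _ hx hy, key]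
  intro s t x y h
  rw [key] at h ⊢
  rw [show (s • x) ∘ f = s • (x ∘ f) from rfl, eval_smul_of_isHomogeneous hφ, h, mul_zero]

lemma mk_mem_Vbi_rename_inr_iff {a b c k : ℕ} {φ : MvPolynomial (Fin c) ℂ}
    (hφ : φ.IsHomogeneous k) (f : Fin c → Fin b)
    {x : Fin a → ℂ} (hx : x ≠ 0) {y : Fin b → ℂ} (hy : y ≠ 0) :
    (Projectivization.mk ℂ x hx, Projectivization.mk ℂ y hy) ∈ Vbi (rename (Sum.inr ∘ f) φ) ↔
      eval (y ∘ f) φ = 0 := by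
  have key (x : Fin a → ℂ) (y : Fin b → ℂ) :
      eval (Sum.elim x y) (rename (Sum.inr ∘ f) φ) = eval (y ∘ f) φ := by
    rw [eval_rename, ← Function.comp_assoc, Sum.elim_comp_inr]
  rw [mk_mem_Vbi_iff _ hx hy, key]
  intro s t x y h
  rw [key] at h ⊢
  rw [show (t • y) ∘ f = t • (y ∘ f) from rfl, eval_smul_of_isHomogeneous hφ, h, mul_zero]

lemma mk_cons_ne_e0 {N : ℕ} (u : ℂ) {x : Fin N → ℂ} (hx : x ≠ 0) :
    Projectivization.mk ℂ (Fin.cons u x : Fin (N + 1) → ℂ) (cons_ne_zero u hx) ≠ e0 := by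
  intro h
  obtain ⟨a, ha⟩ := (Projectivization.mk_eq_mk_iff' ℂ _ _ _ _).mp h
  apply hx
  funext i
  simpa using (congrFun ha i.succ).symm

lemma cons_comp_succ {N : ℕ} (u : ℂ) (x : Fin N → ℂ) :
    (Fin.cons u x : Fin (N + 1) → ℂ) ∘ Fin.succ = x := by
  funext i
  simp

end UGen

/-- Under `X ∩ V(ℓ_x) ∩ V(ℓ_y) = ∅` and `g₀(1,𝟎,1,𝟎) ≠ 0`,
`X̃ ∩ V(g₀, ℓ_x, ℓ_y)` is the disjoint union of
`{([u : x], [1 : 𝟎]) : [x] ∈ π_x(X), ℓ_x(x) = 0, g₀(u,x,1,𝟎) = 0}` and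
`{([1 : 𝟎], [v : y]) : [y] ∈ π_y(X), ℓ_y(y) = 0, g₀(1,𝟎,v,y) = 0}`. -/
theorem statement10 {m n d e : ℕ}
    (X : Set (Projectivization ℂ (Fin (m + 1) → ℂ) × Projectivization ℂ (Fin (n + 1) → ℂ)))
    (hXcl : IsClosed X)
    (ℓx : MvPolynomial (Fin (m + 1)) ℂ) (hℓx : ℓx.IsHomogeneous 1)
    (ℓy : MvPolynomial (Fin (n + 1)) ℂ) (hℓy : ℓy.IsHomogeneous 1)
    (g0 : MvPolynomial (Fin (m + 2) ⊕ Fin (n + 2)) ℂ)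
    (hg0 : UGen.IsBihomogeneous g0 d e) (hd : 1 ≤ d) (he : 1 ≤ e)
    (hslice : X ∩ UGen.Vbi (rename Sum.inl ℓx) ∩ UGen.Vbi (rename Sum.inr ℓy) = ∅)
    (hg0e : eval (Sum.elim (Fin.cons 1 0) (Fin.cons 1 0)) g0 ≠ 0) :
    UGen.doubleCone X ∩ UGen.Vbi g0 ∩ UGen.Vbi (rename (Sum.inl ∘ Fin.succ) ℓx) ∩
        UGen.Vbi (rename (Sum.inr ∘ Fin.succ) ℓy) =
      { q | ∃ (u : ℂ) (x : Fin (m + 1) → ℂ) (hx : x ≠ 0),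
          Projectivization.mk ℂ x hx ∈ Prod.fst '' X ∧ eval x ℓx = 0 ∧
            eval (Sum.elim (Fin.cons u x) (Fin.cons 1 0)) g0 = 0 ∧
            q = (Projectivization.mk ℂ (Fin.cons u x) (UGen.cons_ne_zero u hx),
                 UGen.e0) } ∪
      { q | ∃ (v : ℂ) (y : Fin (n + 1) → ℂ) (hy : y ≠ 0),
          Projectivization.mk ℂ y hy ∈ Prod.snd '' X ∧ eval y ℓy = 0 ∧
            eval (Sum.elim (Fin.cons 1 0) (Fin.cons v y)) g0 = 0 ∧
            q = (UGen.e0,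
                 Projectivization.mk ℂ (Fin.cons v y) (UGen.cons_ne_zero v hy)) } ∧
    Disjoint
      { q | ∃ (u : ℂ) (x : Fin (m + 1) → ℂ) (hx : x ≠ 0),
          Projectivization.mk ℂ x hx ∈ Prod.fst '' X ∧ eval x ℓx = 0 ∧
            eval (Sum.elim (Fin.cons u x) (Fin.cons 1 0)) g0 = 0 ∧
            q = (Projectivization.mk ℂ (Fin.cons u x) (UGen.cons_ne_zero u hx),
                 UGen.e0) }
      { q | ∃ (v : ℂ) (y : Fin (n + 1) → ℂ) (hy : y ≠ 0),
          Projectivization.mk ℂ y hy ∈ Prod.snd '' X ∧ eval y ℓy = 0 ∧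
            eval (Sum.elim (Fin.cons 1 0) (Fin.cons v y)) g0 = 0 ∧
            q = (UGen.e0,
                 Projectivization.mk ℂ (Fin.cons v y) (UGen.cons_ne_zero v hy)) } := by
  have hx0 := UGen.eval_zero_of_isHomogeneous one_ne_zero hℓx
  have hy0 := UGen.eval_zero_of_isHomogeneous one_ne_zero hℓy
  refine ⟨Set.Subset.antisymm ?_ ?_, ?_⟩
  · rintro q ⟨⟨⟨hq, hg⟩, hqx⟩, hqy⟩
    rcases hq with ((⟨u, v, x, y, hx, hy, hX, rfl⟩ | ⟨u, x, hx, hX, rfl⟩) |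
      ⟨v, y, hy, hX, rfl⟩) | rfl
    · rw [UGen.mk_mem_Vbi_rename_inl_iff hℓx, UGen.cons_comp_succ] at hqx
      rw [UGen.mk_mem_Vbi_rename_inr_iff hℓy, UGen.cons_comp_succ] at hqy
      have hmem : (Projectivization.mk ℂ x hx, Projectivization.mk ℂ y hy) ∈
          X ∩ UGen.Vbi (rename Sum.inl ℓx) ∩ UGen.Vbi (rename Sum.inr ℓy) :=
        ⟨⟨hX, (UGen.mk_mem_Vbi_rename_inl_iff hℓx id hx hy).mpr hqx⟩,
          (UGen.mk_mem_Vbi_rename_inr_iff hℓy id hx hy).mpr hqy⟩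
      rw [hslice] at hmem
      exact hmem.elim
    · rw [UGen.e0, UGen.mk_mem_Vbi_rename_inl_iff hℓx, UGen.cons_comp_succ] at hqx
      rw [UGen.e0, hg0.mk_mem_Vbi_iff] at hg
      exact Or.inl ⟨u, x, hx, hX, hqx, hg, rfl⟩
    · rw [UGen.e0, UGen.mk_mem_Vbi_rename_inr_iff hℓy, UGen.cons_comp_succ] at hqy
      rw [UGen.e0, hg0.mk_mem_Vbi_iff] at hg
      exact Or.inr ⟨v, y, hy, hX, hqy, hg, rfl⟩
    · rw [UGen.e0, UGen.e0, hg0.mk_mem_Vbi_iff] at hg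
      exact (hg0e hg).elim
  · rintro q (⟨u, x, hx, hX, hℓ, hg, rfl⟩ | ⟨v, y, hy, hX, hℓ, hg, rfl⟩)
    · refine ⟨⟨⟨Or.inl (Or.inl (Or.inr ⟨u, x, hx, hX, rfl⟩)), ?_⟩, ?_⟩, ?_⟩
      · rwa [UGen.e0, hg0.mk_mem_Vbi_iff]
      · rwa [UGen.e0, UGen.mk_mem_Vbi_rename_inl_iff hℓx, UGen.cons_comp_succ]
      · rwa [UGen.e0, UGen.mk_mem_Vbi_rename_inr_iff hℓy, UGen.cons_comp_succ]
    · refine ⟨⟨⟨Or.inl (Or.inr ⟨v, y, hy, hX, rfl⟩), ?_⟩, ?_⟩, ?_⟩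
      · rwa [UGen.e0, hg0.mk_mem_Vbi_iff]
      · rwa [UGen.e0, UGen.mk_mem_Vbi_rename_inl_iff hℓx, UGen.cons_comp_succ]
      · rwa [UGen.e0, UGen.mk_mem_Vbi_rename_inr_iff hℓy, UGen.cons_comp_succ]
  · rw [Set.disjoint_left]
    rintro q ⟨u, x, hx, -, -, -, rfl⟩ ⟨v, y, hy, -, -, -, hq⟩
    exact UGen.mk_cons_ne_e0 u hx (congrArg Prod.fst hq)
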